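/- Let ν : ℝ^d∖{0} → [0,∞] be radial, p ≥ 1, and suppose ν satisfies assumptions (A),(B),(C) with associated critical Young function φ(t) = c t^q for some c, q > 0. Then necessarily 1/p − 1/d < 1/q < 1/p, and setting s = d/p − d/q ∈ (0,1), there is a constant C_{p,q,d} > 0 such that ν(h) = C_{p,q,d} |h|^{−d−sp} for a.e. h ≠ 0. Explicitly, C_{p,q,d} = c^{p/q}(1 − p/q) c_d^{p/q − 2} with c_d = |B(0,1)|. -/

import Mathlib

open MeasureTheory ENNReal

lemma aux_pow {d : ℕ} (hd : 1 ≤ d) (K e y : ℝ) (hy : 0 < y) :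
    y ^ (d - 1) * (K * y ^ e) = K * y ^ (e + d - 1) := by
  rw [← Real.rpow_natCast y (d-1), mul_left_comm, ← Real.rpow_add hy]
  congr 2
  push_cast [hd]
  ring

lemma tail_g {d : ℕ} (hd : 1 ≤ d) (K e R : ℝ) (hK : 0 ≤ K) (he : e < -d) (hR : 0 < R) :
    ∫⁻ h in {h : EuclideanSpace ℝ (Fin d) | R < ‖h‖}, ENNReal.ofReal (K * ‖h‖ ^ e)
      = ENNReal.ofReal (d * ((volume (Metric.ball (0 : EuclideanSpace ℝ (Fin d)) 1)).toReal *
        (K * (-R ^ (e + d) / (e + d))))) := by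
  have : Nonempty (Fin d) := ⟨⟨0, hd⟩⟩
  have hms : MeasurableSet {h : EuclideanSpace ℝ (Fin d) | R < ‖h‖} :=
    measurableSet_lt measurable_const measurable_norm
  set f : ℝ → ℝ := Set.indicator (Set.Ioi R) (fun y => K * y ^ e) with hf
  have hfn : ∀ y, 0 ≤ f y := by
    intro y
    apply Set.indicator_nonneg
    intro x hx
    have : 0 < x := hR.trans hx
    positivity
  have h1 : ∫⁻ h in {h : EuclideanSpace ℝ (Fin d) | R < ‖h‖}, ENNReal.ofReal (K * ‖h‖ ^ e)
      = ∫⁻ h : EuclideanSpace ℝ (Fin d), ENNReal.ofReal (f ‖h‖) := by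
    rw [← lintegral_indicator hms]
    congr 1
    ext h
    by_cases hh : R < ‖h‖ <;> simp [hf, Set.indicator, hh]
  have heq : Set.EqOn (fun y : ℝ => y ^ (d - 1) • f y)
      (Set.indicator (Set.Ioi R) (fun y => K * y ^ (e + d - 1))) (Set.Ioi 0) := by
    intro y hy
    by_cases hh : R < y
    · simpa [hf, Set.indicator, hh] using aux_pow hd K e y hy
    · simp [hf, Set.indicator, hh]
  have hlt : e + d - 1 < -1 := by linarith
  have hint1 : IntegrableOn (fun y : ℝ => K * y ^ (e + d - 1)) (Set.Ioi R) :=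
    (integrableOn_Ioi_rpow_of_lt hlt hR).const_mul K
  have hint : Integrable (fun h : EuclideanSpace ℝ (Fin d) => f ‖h‖) := by
    rw [integrable_fun_norm_addHaar volume (f := f)]
    simp only [finrank_euclideanSpace, Fintype.card_fin]
    rw [integrableOn_congr_fun heq measurableSet_Ioi]
    exact ((integrable_indicator_iff measurableSet_Ioi).2 hint1).integrableOn
  rw [h1, ← ofReal_integral_eq_lintegral_ofReal hint (Filter.Eventually.of_forall fun h => hfn _),
    integral_fun_norm_addHaar volume f]
  simp only [finrank_euclideanSpace, Fintype.card_fin]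
  rw [setIntegral_congr_fun measurableSet_Ioi heq, setIntegral_indicator measurableSet_Ioi,
    Set.inter_eq_right.2 (Set.Ioi_subset_Ioi hR.le), integral_const_mul,
    integral_Ioi_rpow_of_lt hlt hR]
  simp [measureReal_def]

lemma ae_of_tail {d : ℕ} (hd : 1 ≤ d) (ν g : ℝ → ℝ≥0∞) (hν : Measurable ν) (hg : Measurable g)
    (hfin : ∀ R : ℝ, 0 < R → ∫⁻ h in {h : EuclideanSpace ℝ (Fin d) | R < ‖h‖}, ν ‖h‖ ≠ ⊤)
    (heq : ∀ R : ℝ, 0 < R → ∫⁻ h in {h : EuclideanSpace ℝ (Fin d) | R < ‖h‖}, ν ‖h‖ =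
      ∫⁻ h in {h : EuclideanSpace ℝ (Fin d) | R < ‖h‖}, g ‖h‖) :
    ∀ᵐ h : EuclideanSpace ℝ (Fin d), ν ‖h‖ = g ‖h‖ := by
  have : Nonempty (Fin d) := ⟨⟨0, hd⟩⟩
  set m : Measure ℝ := (volume : Measure (EuclideanSpace ℝ (Fin d))).map norm with hm
  have conv : ∀ (u : ℝ → ℝ≥0∞), Measurable u → ∀ R, ∫⁻ y in Set.Ioi R, u y ∂m =
      ∫⁻ h in {h : EuclideanSpace ℝ (Fin d) | R < ‖h‖}, u ‖h‖ := by
    intro u hu R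
    rw [hm, setLIntegral_map measurableSet_Ioi hu measurable_norm]
    rfl
  have key : ∀ R : ℝ, 0 < R → ν =ᵐ[m.restrict (Set.Ioi R)] g := by
    intro R hR
    have hf' : ∫⁻ y, ν y ∂(m.restrict (Set.Ioi R)) ≠ ⊤ := by
      rw [conv ν hν]; exact hfin R hR
    rw [← withDensity_eq_iff hν.aemeasurable hg.aemeasurable hf']
    have : IsFiniteMeasure ((m.restrict (Set.Ioi R)).withDensity ν) :=
      isFiniteMeasure_withDensity hf'
    refine ext_of_generate_finite (Set.range Set.Ioi)
      (BorelSpace.measurable_eq.trans (borel_eq_generateFrom_Ioi ℝ)) isPiSystem_Ioi ?_ ?_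
    · rintro _ ⟨a, rfl⟩
      rw [withDensity_apply _ measurableSet_Ioi, withDensity_apply _ measurableSet_Ioi,
        Measure.restrict_restrict measurableSet_Ioi, Set.Ioi_inter_Ioi, conv ν hν, conv g hg]
      exact heq _ (lt_max_of_lt_right hR)
    · rw [withDensity_apply _ .univ, withDensity_apply _ .univ, Measure.restrict_univ,
        conv ν hν, conv g hg]
      exact heq _ hR
  have key2 : ∀ n : ℕ, ∀ᵐ h : EuclideanSpace ℝ (Fin d), (1 / ((n : ℝ) + 1)) < ‖h‖ →
      ν ‖h‖ = g ‖h‖ := by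
    intro n
    have h1 := key (1 / ((n : ℝ) + 1)) (by positivity)
    rw [Filter.EventuallyEq, ae_restrict_iff' measurableSet_Ioi] at h1
    exact ae_of_ae_map measurable_norm.aemeasurable h1
  have h0 : ∀ᵐ h : EuclideanSpace ℝ (Fin d), h ≠ 0 := by
    rw [ae_iff]; simp
  filter_upwards [ae_all_iff.2 key2, h0] with h hh hne
  obtain ⟨n, hn⟩ := exists_nat_one_div_lt (norm_pos_iff.2 hne)
  exact hh n hn

lemma tail_zero {d : ℕ} (ν : ℝ → ℝ≥0∞) (hν : Measurable ν)
    (hfin : ∀ R : ℝ, 0 < R → ∫⁻ h in {h : EuclideanSpace ℝ (Fin d) | R < ‖h‖}, ν ‖h‖ ≠ ⊤)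
    (ε : ℝ≥0∞) (hε : 0 < ε) :
    ∃ R : ℝ, 1 ≤ R ∧ ∫⁻ h in {h : EuclideanSpace ℝ (Fin d) | R < ‖h‖}, ν ‖h‖ < ε := by
  set M := (volume : Measure (EuclideanSpace ℝ (Fin d))).withDensity (fun h => ν ‖h‖) with hM
  set s : ℕ → Set (EuclideanSpace ℝ (Fin d)) := fun n => {h | (n : ℝ) + 1 < ‖h‖} with hs
  have hms : ∀ n, MeasurableSet (s n) := fun n => measurableSet_lt measurable_const measurable_norm
  have hMs : ∀ n, M (s n) = ∫⁻ h in {h : EuclideanSpace ℝ (Fin d) | (n : ℝ) + 1 < ‖h‖}, ν ‖h‖ :=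
    fun n => withDensity_apply _ (hms n)
  have hanti : Antitone s := by
    intro a b hab h (hh : (b : ℝ) + 1 < ‖h‖)
    have : (a : ℝ) ≤ b := by exact_mod_cast hab
    show (a : ℝ) + 1 < ‖h‖
    linarith
  have ht := tendsto_measure_iInter_atTop (μ := M) (fun n => (hms n).nullMeasurableSet) hanti
    ⟨0, by rw [hMs]; exact hfin _ (by positivity)⟩
  have hemp : ⋂ n, s n = ∅ := by
    ext h
    simp only [Set.mem_iInter, Set.mem_empty_iff_false, iff_false, not_forall]
    obtain ⟨n, hn⟩ := exists_nat_gt ‖h‖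
    refine ⟨n, ?_⟩
    show ¬ ((n : ℝ) + 1 < ‖h‖)
    linarith
  rw [hemp, measure_empty] at ht
  obtain ⟨n, hn⟩ := (ht.eventually (gt_mem_nhds hε)).exists
  refine ⟨n + 1, by linarith [(Nat.cast_nonneg n : (0:ℝ) ≤ n)], ?_⟩
  rw [← hMs]; exact hn

lemma levy_exp {d : ℕ} (hd : 1 ≤ d) (p K e : ℝ) (hp : 1 ≤ p) (hK : 0 < K)
    (h : ∫⁻ h : EuclideanSpace ℝ (Fin d),
      ENNReal.ofReal (min 1 (‖h‖ ^ p)) * ENNReal.ofReal (K * ‖h‖ ^ e) < ⊤) :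
    0 < p + e + d := by
  have : Nonempty (Fin d) := ⟨⟨0, hd⟩⟩
  have hI : IntegrableOn (fun x : EuclideanSpace ℝ (Fin d) =>
      (fun y : ℝ => y ^ p * (K * y ^ e)) ‖x‖) (Metric.ball 0 1) := by
    refine ⟨by fun_prop, ?_⟩
    rw [hasFiniteIntegral_iff_ofReal (Filter.Eventually.of_forall fun x => by positivity)]
    refine lt_of_le_of_lt ?_ h
    refine le_trans (setLIntegral_mono' measurableSet_ball ?_) (setLIntegral_le_lintegral _ _)
    intro x hx
    have hx1 : ‖x‖ < 1 := by simpa using hx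
    have : ‖x‖ ^ p ≤ 1 := Real.rpow_le_one (norm_nonneg _) hx1.le (by linarith)
    rw [min_eq_right this, ← ENNReal.ofReal_mul (by positivity)]
  rw [integrableOn_fun_norm_addHaar volume (f := fun y : ℝ => y ^ p * (K * y ^ e))] at hI
  simp only [finrank_euclideanSpace, Fintype.card_fin] at hI
  have heq : Set.EqOn (fun y : ℝ => y ^ (d - 1) • (y ^ p * (K * y ^ e)))
      (fun y => K * y ^ (p + e + d - 1)) (Set.Ioo 0 1) := by
    intro y hy
    have := aux_pow hd K (p + e) y hy.1
    simp only [smul_eq_mul]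
    rw [← this, Real.rpow_add hy.1]; ring
  rw [integrableOn_congr_fun heq measurableSet_Ioo] at hI
  have h2 := hI.const_mul K⁻¹
  simp only [inv_mul_cancel_left₀ hK.ne'] at h2
  have h3 := (intervalIntegral.integrableOn_Ioo_rpow_iff zero_lt_one).1 h2
  linarith

/-- if a radial kernel `ν` (given by its radial profile) is `p`-Lévy
integrable, almost decreasing (assumption (A)), its critical function is `φ(t) = c t^q`
(assumption (B), expressed by the identity `∫_{|h| > η(r)} ν = c^{p/q} r^{p/q − 1}`, which is
exactly `w^p(r)/r` for `w(r) = 1/φ⁻¹(1/r)`), and `φ_p(t) = c t^{q/p}` is convex and satisfies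
the growth condition (assumption (C)), then necessarily `1/p − 1/d < 1/q < 1/p` and, with
`s = d/p − d/q ∈ (0,1)`, `ν(h) = c^{p/q}(1 − p/q) c_d^{p/q−2} |h|^{−d−sp}` for a.e. `h`. -/
theorem stmt_17 {d : ℕ} (hd : 1 ≤ d) (p q c : ℝ) (hp : 1 ≤ p) (hq : 0 < q) (hc : 0 < c)
    (ν : ℝ → ℝ≥0∞) (hν : Measurable ν)
    (hlevy : ∫⁻ h : EuclideanSpace ℝ (Fin d),
      ENNReal.ofReal (min 1 (‖h‖ ^ p)) * ν ‖h‖ < ⊤)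
    (hdec : ∃ κ : ℝ, 0 < κ ∧ κ ≤ 1 ∧
      ∀ r₁ r₂ : ℝ, 0 ≤ r₂ → r₂ ≤ r₁ → ENNReal.ofReal κ * ν r₁ ≤ ν r₂)
    (hcrit : ∀ r : ℝ, 0 < r →
      ∫⁻ h in {h : EuclideanSpace ℝ (Fin d) |
          (r / (volume (Metric.ball (0 : EuclideanSpace ℝ (Fin d)) 1)).toReal) ^ ((1 : ℝ) / d)
          < ‖h‖}, ν ‖h‖
        = ENNReal.ofReal (c ^ (p / q) * r ^ (p / q - 1)))
    (hconvp : ConvexOn ℝ (Set.Ici 0) fun t => c * t ^ (q / p))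
    (hgrowth : ∃ θ : ℝ, 0 < θ ∧ ∀ s t : ℝ, 0 ≤ s → s ≤ t →
      c * (θ ^ p * s / t) ^ (q / p) ≤ (c * s ^ (q / p)) / (c * t ^ (q / p))) :
    (1 / p - 1 / (d : ℝ) < 1 / q ∧ 1 / q < 1 / p) ∧
      ∀ᵐ h : EuclideanSpace ℝ (Fin d),
        ν ‖h‖ = ENNReal.ofReal (c ^ (p / q) * (1 - p / q) *
          (volume (Metric.ball (0 : EuclideanSpace ℝ (Fin d)) 1)).toReal ^ (p / q - 2) *
            ‖h‖ ^ (-(d : ℝ) - ((d : ℝ) / p - (d : ℝ) / q) * p)) := by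
  have hV : 0 < (volume (Metric.ball (0 : EuclideanSpace ℝ (Fin d)) 1)).toReal :=
    ENNReal.toReal_pos (Metric.measure_ball_pos _ _ one_pos).ne' measure_ball_lt_top.ne
  set V := (volume (Metric.ball (0 : EuclideanSpace ℝ (Fin d)) 1)).toReal with hVdef
  have hp0 : 0 < p := by linarith
  have hd0 : (0 : ℝ) < d := by exact_mod_cast hd
  have hcp : 0 < c ^ (p / q) := Real.rpow_pos_of_pos hc _
  have hT : ∀ R : ℝ, 0 < R → ∫⁻ h in {h : EuclideanSpace ℝ (Fin d) | R < ‖h‖}, ν ‖h‖ =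
      ENNReal.ofReal (c ^ (p / q) * (V * R ^ (d : ℝ)) ^ (p / q - 1)) := by
    intro R hR
    have := hcrit (V * R ^ (d : ℝ)) (by positivity)
    rw [mul_div_cancel_left₀ _ hV.ne', ← Real.rpow_mul hR.le, mul_one_div_cancel hd0.ne',
      Real.rpow_one] at this
    exact this
  have hfin : ∀ R : ℝ, 0 < R →
      ∫⁻ h in {h : EuclideanSpace ℝ (Fin d) | R < ‖h‖}, ν ‖h‖ ≠ ⊤ := by
    intro R hR; rw [hT R hR]; exact ENNReal.ofReal_ne_top
  have hpq : p / q < 1 := by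
    by_contra! hcon
    obtain ⟨R, hR1, hR⟩ := tail_zero ν hν hfin
      (ENNReal.ofReal (c ^ (p / q) * V ^ (p / q - 1))) (ENNReal.ofReal_pos.2 (by positivity))
    rw [hT R (by linarith)] at hR
    refine absurd hR (not_lt.2 (ENNReal.ofReal_le_ofReal ?_))
    have : 1 ≤ R ^ (d : ℝ) := Real.one_le_rpow hR1 hd0.le
    refine mul_le_mul_of_nonneg_left (Real.rpow_le_rpow hV.le ?_ (by linarith)) hcp.le
    nlinarith
  have hpltq : p < q := by rwa [div_lt_one hq] at hpq
  set a := p / q with ha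
  have hexp : -(d : ℝ) - ((d : ℝ) / p - (d : ℝ) / q) * p = d * (a - 1) - d := by
    rw [ha]; field_simp; ring
  rw [hexp]
  set e := (d : ℝ) * (a - 1) - d with he
  set K := c ^ a * (1 - a) * V ^ (a - 2) with hK
  have hKpos : 0 < K := by
    have : 0 < 1 - a := by linarith
    positivity
  have hae : ∀ᵐ h : EuclideanSpace ℝ (Fin d), ν ‖h‖ = ENNReal.ofReal (K * ‖h‖ ^ e) := by
    refine ae_of_tail hd ν (fun y => ENNReal.ofReal (K * y ^ e)) hν (by fun_prop) hfin ?_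
    intro R hR
    rw [hT R hR, tail_g hd K e R hKpos.le (by rw [he]; nlinarith) hR]
    congr 1
    rw [← hVdef, show e + d = d * (a - 1) by rw [he]; ring, Real.mul_rpow hV.le (by positivity),
      ← Real.rpow_mul hR.le, hK, show a - 1 = (a - 2) + 1 by ring, Real.rpow_add_one hV.ne']
    have : a - 2 + 1 ≠ 0 := by linarith
    field_simp
    ring
  refine ⟨⟨?_, one_div_lt_one_div_of_lt hp0 hpltq⟩, hae⟩
  have hl : ∫⁻ h : EuclideanSpace ℝ (Fin d),
      ENNReal.ofReal (min 1 (‖h‖ ^ p)) * ENNReal.ofReal (K * ‖h‖ ^ e) < ⊤ := by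
    refine lt_of_eq_of_lt (lintegral_congr_ae ?_) hlevy
    filter_upwards [hae] with h hh
    rw [hh]
  have h3 := levy_exp hd p K e hp hKpos hl
  have h4 : d * (1 - a) < p := by rw [he] at h3; linarith
  have h5 : 1 / p - 1 / q = (d * (1 - a)) / (p * d) := by rw [ha]; field_simp
  have h6 : (d * (1 - a)) / (p * d) < 1 / d := by
    rw [div_lt_div_iff₀ (by positivity) hd0]; nlinarith
  linarith
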